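/- Under the smoothness and convexity assumptions, let 0 < μ⁺ ≤ μ ≤ 1/2 with μ ≤ 2μ⁺, let the step size satisfy 0 < η ≤ 1/L_{ψμ}, and let x, y, v be arbitrary with v⁺ := v + η(∇_y F(x,y) − ∇²_{yy} ψ_μ(x,y)v) and x⁺ ∈ ℝⁿ arbitrary. Then ‖v⁺ − v*_{μ⁺}(x⁺)‖² − ‖v − v*_μ(x)‖² ≤ −(1/2) η σ_{ψμ} ‖v − v*_μ(x)‖² + (6(L_{v1}‖v*_μ(x)‖ + L_{v2})²/(η σ_{ψμ}⁵)) ‖x − x⁺‖² + (3η/σ_{ψμ}) (L_{ψyy2}‖v*_μ(x)‖ + L_{Fy2})² ‖y − y*_μ(x)‖² + (6(C_{v1}‖v*_{μ⁺}(x⁺)‖ + C_{v2})² ‖∇_y F(x⁺, y*_{μ⁺}(x⁺))‖²/(η σ_{ψμ})) ((μ − μ⁺)/μ²)². -/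

import Mathlib

open Set Filter Asymptotics
open scoped NNReal

noncomputable section

/-- `ℝⁿ` as a Euclidean space. -/
abbrev Eu (n : ℕ) : Type := EuclideanSpace ℝ (Fin n)

variable {n m : ℕ}

/-- Partial gradient with respect to the first (upper-level) variable. -/
def gradx (F : Eu n → Eu m → ℝ) (x : Eu n) (y : Eu m) : Eu n :=
  gradient (fun x' => F x' y) x

/-- Partial gradient with respect to the second (lower-level) variable. -/
def grady (F : Eu n → Eu m → ℝ) (x : Eu n) (y : Eu m) : Eu m :=
  gradient (fun y' => F x y') y

/-- Second-order partial derivative `∇²_{yy}`. -/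
def hessyy (F : Eu n → Eu m → ℝ) (x : Eu n) (y : Eu m) : Eu m →L[ℝ] Eu m :=
  fderiv ℝ (fun y' => grady F x y') y

/-- Mixed second-order partial derivative `∇²_{xy}`, viewed as the linear map
sending a multiplier `v ∈ ℝᵐ` to an element of `ℝⁿ`. -/
def hessxy (F : Eu n → Eu m → ℝ) (x : Eu n) (y : Eu m) : Eu m →L[ℝ] Eu n :=
  ContinuousLinearMap.adjoint (fderiv ℝ (fun x' => grady F x' y) x)

/-- The aggregation function `ψ_μ = μ F + (1-μ) f`. -/
def aggreg (μ : ℝ) (F f : Eu n → Eu m → ℝ) : Eu n → Eu m → ℝ :=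
  fun x y => μ * F x y + (1 - μ) * f x y

/-- The squared KKT residual of the equality-constrained reformulation
`min F(x,y) s.t. ∇_y f(x,y) = 0`. -/
def KKTres (F f : Eu n → Eu m → ℝ) (x : Eu n) (y v : Eu m) : ℝ :=
  ‖gradx F x y - hessxy f x y v‖ ^ 2 + ‖grady F x y - hessyy f x y v‖ ^ 2 +
    ‖grady f x y‖ ^ 2

section GeneralFacts

variable {E : Type*} [NormedAddCommGroup E] [InnerProductSpace ℝ E]

lemma mul_norm_le_norm_of_mul_sq_le_inner {c : ℝ} {u w : E}
    (h : c * ‖u‖ ^ 2 ≤ inner ℝ w u) : c * ‖u‖ ≤ ‖w‖ := by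
  rcases (norm_nonneg u).eq_or_lt with hu | hu
  · rw [← hu, mul_zero]
    exact norm_nonneg w
  · refine le_of_mul_le_mul_right ?_ hu
    nlinarith [real_inner_le_norm w u]

/-- A strongly monotone operator on a finite-dimensional space is invertible. -/
lemma isInvertible_of_mul_sq_le_inner [FiniteDimensional ℝ E] {T : E →L[ℝ] E} {c : ℝ}
    (hc : 0 < c) (hT : ∀ u, c * ‖u‖ ^ 2 ≤ inner ℝ (T u) u) : T.IsInvertible := by
  have hinj : Function.Injective (T : E →ₗ[ℝ] E) := by
    rw [injective_iff_map_eq_zero]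
    intro u hu
    have h := mul_norm_le_norm_of_mul_sq_le_inner (hT u)
    have hu' : T u = 0 := hu
    rw [hu', norm_zero] at h
    exact norm_le_zero_iff.1 (by nlinarith [norm_nonneg u])
  refine ⟨(LinearEquiv.ofInjectiveEndo (T : E →ₗ[ℝ] E) hinj).toContinuousLinearEquiv, ?_⟩
  ext u
  rfl

/-- Perturbation bound for the solutions of two linear systems `T₁ v₁ = g₁`, `T₂ v₂ = g₂`. -/
lemma mul_norm_sub_le_of_apply_eq {T₁ T₂ : E →L[ℝ] E} {v₁ v₂ g₁ g₂ : E} {c : ℝ}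
    (h₁ : T₁ v₁ = g₁) (h₂ : T₂ v₂ = g₂) (hT₂ : ∀ u, c * ‖u‖ ^ 2 ≤ inner ℝ (T₂ u) u) :
    c * ‖v₁ - v₂‖ ≤ ‖T₁ - T₂‖ * ‖v₁‖ + ‖g₁ - g₂‖ := by
  have h : T₂ (v₁ - v₂) = (g₁ - g₂) - (T₁ - T₂) v₁ := by
    rw [map_sub, h₂, sub_apply, h₁]
    abel
  calc c * ‖v₁ - v₂‖ ≤ ‖T₂ (v₁ - v₂)‖ := mul_norm_le_norm_of_mul_sq_le_inner (hT₂ _)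
    _ ≤ ‖g₁ - g₂‖ + ‖(T₁ - T₂) v₁‖ := h ▸ norm_sub_le _ _
    _ ≤ ‖T₁ - T₂‖ * ‖v₁‖ + ‖g₁ - g₂‖ := by
      rw [add_comm]
      gcongr
      exact (T₁ - T₂).le_opNorm v₁

/-- The gradient-step operator `I - η T` is a contraction with factor `1 - η c`. -/
lemma norm_sub_smul_apply_le {T : E →L[ℝ] E} {c L η : ℝ} (hη : 0 ≤ η) (hηL : η * L ≤ 1)
    (hηc : η * c ≤ 1) (hsymm : (T : E →ₗ[ℝ] E).IsSymmetric)
    (hT : ∀ u, c * ‖u‖ ^ 2 ≤ inner ℝ (T u) u) (hL : ‖T‖ ≤ L) (u : E) :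
    ‖u - η • T u‖ ≤ (1 - η * c) * ‖u‖ := by
  set S : E →L[ℝ] E := ContinuousLinearMap.id ℝ E - η • T with hS
  have hSsymm : (S : E →ₗ[ℝ] E).IsSymmetric := by
    intro a b
    have := hsymm a b
    simp only [ContinuousLinearMap.coe_coe] at this
    simp [hS, inner_sub_left, inner_sub_right, inner_smul_left, inner_smul_right, this]
  have hSnorm : ‖S‖ ≤ 1 - η * c := by
    rw [ContinuousLinearMap.norm_eq_iSup_rayleighQuotient S hSsymm]
    refine ciSup_le fun w => ?_
    have hw : S.reApplyInnerSelf w = ‖w‖ ^ 2 - η * inner ℝ (T w) w := by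
      simp [ContinuousLinearMap.reApplyInnerSelf_apply, hS, inner_sub_left, inner_smul_left]
    have hup : inner ℝ (T w) w ≤ L * ‖w‖ ^ 2 := by
      refine (real_inner_le_norm _ _).trans ?_
      have := (T.le_opNorm w).trans (mul_le_mul_of_nonneg_right hL (norm_nonneg w))
      nlinarith [norm_nonneg w]
    rw [ContinuousLinearMap.rayleighQuotient, hw, abs_of_nonneg]
    · refine div_le_of_le_mul₀ (sq_nonneg _) (by linarith) ?_
      nlinarith [mul_le_mul_of_nonneg_left (hT w) hη]
    · refine div_nonneg ?_ (sq_nonneg _)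
      nlinarith [mul_le_mul_of_nonneg_left hup hη, sq_nonneg ‖w‖]
  have h := (S.le_opNorm u).trans (mul_le_mul_of_nonneg_right hSnorm (norm_nonneg u))
  simpa [hS] using h

/-- The derivative of a strongly monotone map is coercive. -/
lemma mul_sq_le_inner_fderiv {g : E → E} {c : ℝ} {y : E} (hg : DifferentiableAt ℝ g y)
    (hmono : ∀ a b, c * ‖b - a‖ ^ 2 ≤ inner ℝ (g b - g a) (b - a)) (u : E) :
    c * ‖u‖ ^ 2 ≤ inner ℝ (fderiv ℝ g y u) u := by
  have hlim : Tendsto (fun t : ℝ => inner ℝ (t⁻¹ • (g (y + t • u) - g y)) u) (nhdsWithin 0 (Ioi 0))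
      (nhds (inner ℝ (fderiv ℝ g y u) u)) := by
    have := (hg.hasFDerivAt.hasLineDerivAt u).tendsto_slope_zero_right
    simpa using this.inner tendsto_const_nhds
  refine ge_of_tendsto hlim ?_
  filter_upwards [self_mem_nhdsWithin] with t ht
  have ht : 0 < t := ht
  have h := hmono y (y + t • u)
  rw [add_sub_cancel_left, norm_smul, inner_smul_right, Real.norm_of_nonneg ht.le] at h
  rw [inner_smul_left, RCLike.conj_to_real, ← div_eq_inv_mul, le_div_iff₀ ht]
  refine le_of_mul_le_mul_left ?_ ht
  nlinarith

variable [CompleteSpace E]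

/-- The gradient of a differentiable strongly convex function is strongly monotone. -/
lemma StrongConvexOn.mul_sq_le_inner_gradient_sub {p : E → ℝ} {c : ℝ}
    (hp : StrongConvexOn univ c p) (hd : Differentiable ℝ p) (a b : E) :
    c * ‖b - a‖ ^ 2 ≤ inner ℝ (gradient p b - gradient p a) (b - a) := by
  have hconv := strongConvexOn_iff_convex.1 hp
  set u := b - a with hu
  have hline : ∀ t : ℝ, HasDerivAt (fun s : ℝ => a + s • u) u t := fun t => by
    simpa using ((hasDerivAt_id t).smul_const u).const_add a
  have hder : ∀ t : ℝ, HasDerivAt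
      (fun s : ℝ => p (a + s • u) - c / 2 * ‖a + s • u‖ ^ 2)
      (inner ℝ (gradient p (a + t • u)) u - c / 2 * (2 * inner ℝ (a + t • u) u)) t := fun t => by
    have h1 := (hd (a + t • u)).hasFDerivAt.comp_hasDerivAt t (hline t)
    rw [← inner_gradient_left] at h1
    exact h1.sub ((hline t).norm_sq.const_mul _)
  have hc1 : ConvexOn ℝ univ (fun s : ℝ => p (a + s • u) - c / 2 * ‖a + s • u‖ ^ 2) := by
    have := hconv.comp_affineMap (AffineMap.lineMap a b : ℝ →ᵃ[ℝ] E)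
    refine (by simpa using this : ConvexOn ℝ univ _).congr fun s _ => ?_
    simp [AffineMap.lineMap_apply, hu, add_comm]
  have hmono := hc1.monotoneOn_deriv (fun s _ => (hder s).differentiableAt)
    (mem_univ 0) (mem_univ 1) zero_le_one
  rw [(hder 0).deriv, (hder 1).deriv] at hmono
  simp only [zero_smul, one_smul, add_zero, inner_add_left, real_inner_self_eq_norm_sq] at hmono
  rw [hu, add_sub_cancel, ← hu] at hmono
  rw [inner_sub_left]
  linarith

lemma ContDiff.differentiable_gradient {p : E → ℝ} (hp : ContDiff ℝ 2 p) :
    Differentiable ℝ (gradient p) :=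
  (InnerProductSpace.toDual ℝ E).symm.differentiable.comp
    ((hp.fderiv_right (m := 1) (by norm_num)).differentiable (by norm_num))

lemma inner_fderiv_gradient {p : E → ℝ} (hp : ContDiff ℝ 2 p) (y u w : E) :
    inner ℝ (fderiv ℝ (gradient p) y u) w = fderiv ℝ (fderiv ℝ p) y u w := by
  have hd : DifferentiableAt ℝ (fderiv ℝ p) y :=
    (hp.fderiv_right (m := 1) (by norm_num)).differentiable (by norm_num) y
  have h := fderiv_inner_apply ℝ (hp.differentiable_gradient y) (differentiableAt_const w) u
  simp only [inner_gradient_left] at h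
  rw [fderiv_clm_apply hd (differentiableAt_const w)] at h
  simpa using h.symm

lemma ContDiff.isSymmetric_fderiv_gradient {p : E → ℝ} (hp : ContDiff ℝ 2 p) (y : E) :
    (fderiv ℝ (gradient p) y : E →ₗ[ℝ] E).IsSymmetric := by
  intro u w
  rw [ContinuousLinearMap.coe_coe, real_inner_comm (F := E) _ u, inner_fderiv_gradient hp,
    inner_fderiv_gradient hp]
  exact hp.contDiffAt.isSymmSndFDerivAt (by simp) u w

end GeneralFacts

section Aggregation

variable {F f : Eu n → Eu m → ℝ}

lemma ContDiff.differentiable_slice (hF : ContDiff ℝ 2 (Function.uncurry F)) (x : Eu n) :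
    Differentiable ℝ (F x) :=
  (hF.comp (contDiff_prodMk_right x)).differentiable (by norm_num)

lemma ContDiff.differentiable_grady (hF : ContDiff ℝ 2 (Function.uncurry F)) (x : Eu n) :
    Differentiable ℝ (grady F x) :=
  (hF.comp (contDiff_prodMk_right x)).differentiable_gradient

lemma ContDiff.isSymmetric_hessyy (hF : ContDiff ℝ 2 (Function.uncurry F)) (x : Eu n)
    (y : Eu m) : (hessyy F x y : Eu m →ₗ[ℝ] Eu m).IsSymmetric :=
  (hF.comp (contDiff_prodMk_right x)).isSymmetric_fderiv_gradient y

lemma ContDiff.aggreg (hF : ContDiff ℝ 2 (Function.uncurry F))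
    (hf : ContDiff ℝ 2 (Function.uncurry f)) (μ : ℝ) :
    ContDiff ℝ 2 (Function.uncurry (aggreg μ F f)) :=
  (contDiff_const.mul hF).add (contDiff_const.mul hf)

lemma grady_aggreg (hF : ContDiff ℝ 2 (Function.uncurry F))
    (hf : ContDiff ℝ 2 (Function.uncurry f)) (μ : ℝ) (x : Eu n) (y : Eu m) :
    grady (aggreg μ F f) x y = μ • grady F x y + (1 - μ) • grady f x y := by
  have h := ((hF.differentiable_slice x y).hasFDerivAt.const_mul μ).add
    ((hf.differentiable_slice x y).hasFDerivAt.const_mul (1 - μ))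
  have h' : fderiv ℝ (aggreg μ F f x) y = μ • fderiv ℝ (F x) y + (1 - μ) • fderiv ℝ (f x) y :=
    h.fderiv
  simp only [grady, gradient]
  rw [h', map_add, map_smulₛₗ, map_smulₛₗ]
  rfl

lemma hessyy_aggreg (hF : ContDiff ℝ 2 (Function.uncurry F))
    (hf : ContDiff ℝ 2 (Function.uncurry f)) (μ : ℝ) (x : Eu n) (y : Eu m) :
    hessyy (aggreg μ F f) x y = μ • hessyy F x y + (1 - μ) • hessyy f x y := by
  simp only [hessyy, grady_aggreg hF hf]
  exact (((hF.differentiable_grady x y).hasFDerivAt.const_smul μ).add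
    ((hf.differentiable_grady x y).hasFDerivAt.const_smul (1 - μ))).fderiv

lemma mul_sq_le_inner_grady_aggreg_sub (hF : ContDiff ℝ 2 (Function.uncurry F))
    (hf : ContDiff ℝ 2 (Function.uncurry f)) {σ : ℝ} {x : Eu n}
    (hFsc : StrongConvexOn univ σ (F x)) (hfconv : ConvexOn ℝ univ (f x)) {μ : ℝ}
    (hμ : 0 ≤ μ) (hμ1 : μ ≤ 1) (a b : Eu m) :
    μ * σ * ‖b - a‖ ^ 2 ≤
      inner ℝ (grady (aggreg μ F f) x b - grady (aggreg μ F f) x a) (b - a) := by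
  have h1 := hFsc.mul_sq_le_inner_gradient_sub (hF.differentiable_slice x) a b
  have h2 := (strongConvexOn_zero.2 hfconv).mul_sq_le_inner_gradient_sub
    (hf.differentiable_slice x) a b
  rw [zero_mul] at h2
  have h : grady (aggreg μ F f) x b - grady (aggreg μ F f) x a =
      μ • (grady F x b - grady F x a) + (1 - μ) • (grady f x b - grady f x a) := by
    rw [grady_aggreg hF hf, grady_aggreg hF hf]
    module
  rw [h, inner_add_left, real_inner_smul_left, real_inner_smul_left, mul_assoc]
  exact le_add_of_le_of_nonneg (mul_le_mul_of_nonneg_left h1 hμ)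
    (mul_nonneg (sub_nonneg.2 hμ1) h2)

lemma mul_sq_le_inner_hessyy_aggreg (hF : ContDiff ℝ 2 (Function.uncurry F))
    (hf : ContDiff ℝ 2 (Function.uncurry f)) {σ : ℝ} {x : Eu n}
    (hFsc : StrongConvexOn univ σ (F x)) (hfconv : ConvexOn ℝ univ (f x)) {μ : ℝ}
    (hμ : 0 ≤ μ) (hμ1 : μ ≤ 1) (y u : Eu m) :
    μ * σ * ‖u‖ ^ 2 ≤ inner ℝ (hessyy (aggreg μ F f) x y u) u :=
  mul_sq_le_inner_fderiv ((hF.aggreg hf μ).differentiable_grady x y)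
    (mul_sq_le_inner_grady_aggreg_sub hF hf hFsc hfconv hμ hμ1) u

lemma grady_eq_zero_of_forall_le {x : Eu n} {y : Eu m} (h : ∀ z, F x y ≤ F x z) :
    grady F x y = 0 := by
  have hmin : IsLocalMin (F x) y := Eventually.of_forall h
  have h0 : fderiv ℝ (F x) y = 0 := hmin.fderiv_eq_zero
  simp only [grady, gradient]
  rw [h0, map_zero]

lemma norm_hessyy_le {L : ℝ≥0} {x : Eu n} (h : LipschitzWith L fun y => grady F x y) (y : Eu m) :
    ‖hessyy F x y‖ ≤ L :=
  norm_fderiv_le_of_lipschitz ℝ h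

lemma norm_smul_add_one_sub_smul_le {V : Type*} [SeminormedAddCommGroup V] [NormedSpace ℝ V]
    {μ r s : ℝ} (hμ : 0 ≤ μ) (hμ1 : μ ≤ 1) {a b : V} (ha : ‖a‖ ≤ r) (hb : ‖b‖ ≤ s) :
    ‖μ • a + (1 - μ) • b‖ ≤ μ * r + (1 - μ) * s := by
  refine (norm_add_le _ _).trans ?_
  rw [norm_smul, norm_smul, Real.norm_of_nonneg hμ, Real.norm_of_nonneg (sub_nonneg.2 hμ1)]
  have := sub_nonneg.2 hμ1
  gcongr

end Aggregation

/-- Scalar core of the recursion: `a` bounds the contracted error, `R` the residual and `A + B`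
the drift of the target. -/
lemma sq_sub_sq_le_of_contraction {η σ e R A B d : ℝ} (hη : 0 < η) (hσ : 0 < σ)
    (hq : η * σ ≤ 1) (hd : 0 ≤ d)
    (h : d ≤ (1 - η * σ) * e + η * R + (A + B)) :
    d ^ 2 - e ^ 2 ≤ -(1 / 2) * η * σ * e ^ 2 + 3 * η / σ * R ^ 2 +
      6 / (η * σ) * A ^ 2 + 6 / (η * σ) * B ^ 2 := by
  obtain ⟨q, hqdef⟩ : ∃ q, q = η * σ := ⟨_, rfl⟩
  have hq0 : 0 < q := hqdef ▸ mul_pos hη hσ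
  rw [← hqdef] at h hq
  set D := (1 - q) * e + η * R with hD
  have hD2 : D ^ 2 ≤ (1 - q) * e ^ 2 + η / σ * R ^ 2 := by
    have hηR : η * R = q * (R / σ) := by rw [hqdef]; field_simp
    have hηR2 : η / σ * R ^ 2 = q * (R / σ) ^ 2 := by rw [hqdef]; field_simp
    rw [hD, hηR, hηR2]
    nlinarith [mul_nonneg (mul_nonneg hq0.le (sub_nonneg.2 hq)) (sq_nonneg (e - R / σ))]
  have hsum : d ^ 2 ≤ (D + (A + B)) ^ 2 := pow_le_pow_left₀ hd h 2
  have hyoung : (D + (A + B)) ^ 2 ≤ (1 + q / 2) * D ^ 2 + (1 + 2 / q) * (A + B) ^ 2 := by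
    have : (1 + q / 2) * D ^ 2 + (1 + 2 / q) * (A + B) ^ 2 - (D + (A + B)) ^ 2 =
        q / 2 * (D - 2 / q * (A + B)) ^ 2 := by
      field_simp
      ring
    nlinarith [mul_nonneg (half_pos hq0).le (sq_nonneg (D - 2 / q * (A + B)))]
  have hAB : (1 + 2 / q) * (A + B) ^ 2 ≤ 6 / q * A ^ 2 + 6 / q * B ^ 2 := by
    have h1 : 1 + 2 / q ≤ 3 / q := by
      rw [le_div_iff₀ hq0, add_mul, div_mul_cancel₀ _ hq0.ne']
      linarith
    have h2 : (A + B) ^ 2 ≤ 2 * (A ^ 2 + B ^ 2) := add_sq_le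
    calc (1 + 2 / q) * (A + B) ^ 2 ≤ 3 / q * (2 * (A ^ 2 + B ^ 2)) := by gcongr
      _ = 6 / q * A ^ 2 + 6 / q * B ^ 2 := by ring
  have hR2 : 0 ≤ η / σ * R ^ 2 := by positivity
  have hDq := mul_le_mul_of_nonneg_left hD2 (by linarith : 0 ≤ 1 + q / 2)
  have h3 : 3 * η / σ * R ^ 2 = 3 * (η / σ * R ^ 2) := by ring
  have h4 : -(1 / 2) * η * σ * e ^ 2 = -(1 / 2) * q * e ^ 2 := by rw [hqdef]; ring
  rw [h3, h4, ← hqdef]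
  nlinarith [mul_nonneg hR2 (sub_nonneg.2 hq), mul_nonneg (sq_nonneg q) (sq_nonneg e)]

section Sensitivity

variable {F f : Eu n → Eu m → ℝ} {σ μ : ℝ}

lemma norm_hessyy_aggreg_sub_le (hF : ContDiff ℝ 2 (Function.uncurry F))
    (hf : ContDiff ℝ 2 (Function.uncurry f)) (hμ : 0 ≤ μ) (hμ1 : μ ≤ 1) {x x' : Eu n}
    {y y' : Eu m} {r s : ℝ} (hFr : ‖hessyy F x y - hessyy F x' y'‖ ≤ r)
    (hfs : ‖hessyy f x y - hessyy f x' y'‖ ≤ s) :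
    ‖hessyy (aggreg μ F f) x y - hessyy (aggreg μ F f) x' y'‖ ≤ μ * r + (1 - μ) * s := by
  have h : hessyy (aggreg μ F f) x y - hessyy (aggreg μ F f) x' y' =
      μ • (hessyy F x y - hessyy F x' y') + (1 - μ) • (hessyy f x y - hessyy f x' y') := by
    rw [hessyy_aggreg hF hf, hessyy_aggreg hF hf]
    module
  rw [h]
  exact norm_smul_add_one_sub_smul_le hμ hμ1 hFr hfs

/-- Lipschitz dependence of the lower-level minimizer on the upper-level variable. -/
lemma mul_norm_minimizer_sub_le (hF : ContDiff ℝ 2 (Function.uncurry F))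
    (hf : ContDiff ℝ 2 (Function.uncurry f)) {LF Lf : ℝ≥0}
    (hLF : ∀ y, LipschitzWith LF fun x => grady F x y)
    (hLf : ∀ y, LipschitzWith Lf fun x => grady f x y)
    (hFsc : ∀ x, StrongConvexOn univ σ (F x)) (hfconv : ∀ x, ConvexOn ℝ univ (f x))
    (hμ : 0 ≤ μ) (hμ1 : μ ≤ 1) {x x' : Eu n} {y y' : Eu m}
    (hy : grady (aggreg μ F f) x y = 0) (hy' : grady (aggreg μ F f) x' y' = 0) :
    μ * σ * ‖y - y'‖ ≤ (μ * LF + (1 - μ) * Lf) * ‖x - x'‖ := by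
  have h := mul_norm_le_norm_of_mul_sq_le_inner
    (mul_sq_le_inner_grady_aggreg_sub hF hf (hFsc x') (hfconv x') hμ hμ1 y' y)
  have hdiff : grady (aggreg μ F f) x' y - grady (aggreg μ F f) x' y' =
      μ • (grady F x' y - grady F x y) + (1 - μ) • (grady f x' y - grady f x y) := by
    rw [hy', ← hy, grady_aggreg hF hf, grady_aggreg hF hf]
    module
  rw [hdiff] at h
  refine h.trans ((norm_smul_add_one_sub_smul_le hμ hμ1 ((hLF y).norm_sub_le x' x)
    ((hLf y).norm_sub_le x' x)).trans_eq ?_)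
  rw [norm_sub_rev x' x]
  ring

/-- Lipschitz dependence of the multiplier on the upper-level variable. -/
lemma sq_mul_norm_multiplier_sub_le (hF : ContDiff ℝ 2 (Function.uncurry F))
    (hf : ContDiff ℝ 2 (Function.uncurry f)) {LFy1 LFy2 Lfy1 LFyy1 LFyy2 Lfyy1 Lfyy2 : ℝ≥0}
    (hLFy1 : ∀ y, LipschitzWith LFy1 fun x => grady F x y)
    (hLFy2 : ∀ x, LipschitzWith LFy2 fun y => grady F x y)
    (hLfy1 : ∀ y, LipschitzWith Lfy1 fun x => grady f x y)
    (hLFyy1 : ∀ y, LipschitzWith LFyy1 fun x => hessyy F x y)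
    (hLFyy2 : ∀ x, LipschitzWith LFyy2 fun y => hessyy F x y)
    (hLfyy1 : ∀ y, LipschitzWith Lfyy1 fun x => hessyy f x y)
    (hLfyy2 : ∀ x, LipschitzWith Lfyy2 fun y => hessyy f x y)
    (hσ : 0 < σ) (hFsc : ∀ x, StrongConvexOn univ σ (F x))
    (hfconv : ∀ x, ConvexOn ℝ univ (f x)) (hμ : 0 < μ) (hμ1 : μ ≤ 1)
    {x x' : Eu n} {y y' v v' : Eu m}
    (hy : grady (aggreg μ F f) x y = 0) (hy' : grady (aggreg μ F f) x' y' = 0)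
    (hv : hessyy (aggreg μ F f) x y v = grady F x y)
    (hv' : hessyy (aggreg μ F f) x' y' v' = grady F x' y') :
    (μ * σ) ^ 2 * ‖v - v'‖ ≤
      (((μ * LFyy2 + (1 - μ) * Lfyy2) * (μ * LFy1 + (1 - μ) * Lfy1) +
          (μ * LFyy1 + (1 - μ) * Lfyy1) * (μ * σ)) * ‖v‖ +
        (LFy2 * (μ * LFy1 + (1 - μ) * Lfy1) + LFy1 * (μ * σ))) * ‖x - x'‖ := by
  have hdy := mul_norm_minimizer_sub_le hF hf hLFy1 hLfy1 hFsc hfconv hμ.le hμ1 hy hy'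
  have hsys := mul_norm_sub_le_of_apply_eq hv hv'
    (mul_sq_le_inner_hessyy_aggreg hF hf (hFsc x') (hfconv x') hμ.le hμ1 y')
  have hH := norm_hessyy_aggreg_sub_le hF hf hμ.le hμ1
    ((norm_sub_le_norm_sub_add_norm_sub _ (hessyy F x' y) _).trans
      (add_le_add ((hLFyy1 y).norm_sub_le x x') ((hLFyy2 x').norm_sub_le y y')))
    ((norm_sub_le_norm_sub_add_norm_sub _ (hessyy f x' y) _).trans
      (add_le_add ((hLfyy1 y).norm_sub_le x x') ((hLfyy2 x').norm_sub_le y y')))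
  have hg := (norm_sub_le_norm_sub_add_norm_sub (grady F x y) (grady F x' y)
    (grady F x' y')).trans
      (add_le_add ((hLFy1 y).norm_sub_le x x') ((hLFy2 x').norm_sub_le y y'))
  have hσμ : 0 < μ * σ := mul_pos hμ hσ
  have hμ1' := sub_nonneg.2 hμ1
  calc (μ * σ) ^ 2 * ‖v - v'‖ = μ * σ * (μ * σ * ‖v - v'‖) := by ring
    _ ≤ μ * σ * ((μ * (LFyy1 * ‖x - x'‖ + LFyy2 * ‖y - y'‖) +
          (1 - μ) * (Lfyy1 * ‖x - x'‖ + Lfyy2 * ‖y - y'‖)) * ‖v‖ +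
          (LFy1 * ‖x - x'‖ + LFy2 * ‖y - y'‖)) := by
      refine mul_le_mul_of_nonneg_left (hsys.trans ?_) hσμ.le
      gcongr
    _ = ((μ * LFyy2 + (1 - μ) * Lfyy2) * ‖v‖ + LFy2) * (μ * σ * ‖y - y'‖) +
          ((μ * LFyy1 + (1 - μ) * Lfyy1) * ‖v‖ + LFy1) * (μ * σ) * ‖x - x'‖ := by ring
    _ ≤ ((μ * LFyy2 + (1 - μ) * Lfyy2) * ‖v‖ + LFy2) *
            ((μ * LFy1 + (1 - μ) * Lfy1) * ‖x - x'‖) +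
          ((μ * LFyy1 + (1 - μ) * Lfyy1) * ‖v‖ + LFy1) * (μ * σ) * ‖x - x'‖ := by
      gcongr
    _ = _ := by ring

/-- Dependence of the lower-level minimizer on the aggregation parameter. -/
lemma mul_norm_minimizer_sub_le_param (hF : ContDiff ℝ 2 (Function.uncurry F))
    (hf : ContDiff ℝ 2 (Function.uncurry f)) {x : Eu n}
    (hFsc : StrongConvexOn univ σ (F x)) (hfconv : ConvexOn ℝ univ (f x))
    {μ' : ℝ} (hμ' : 0 ≤ μ') (hle : μ' ≤ μ) (hμ : μ ≤ 1 / 2) {y y' : Eu m}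
    (hy : grady (aggreg μ F f) x y = 0) (hy' : grady (aggreg μ' F f) x y' = 0) :
    μ * σ * ‖y' - y‖ ≤ 2 * (μ - μ') * ‖grady F x y'‖ := by
  have h := mul_norm_le_norm_of_mul_sq_le_inner
    (mul_sq_le_inner_grady_aggreg_sub hF hf hFsc hfconv (hμ'.trans hle) (by linarith) y y')
  have hpos : 0 < 1 - μ' := by linarith
  have hf' : (1 - μ') • grady f x y' = -(μ' • grady F x y') := by
    rw [grady_aggreg hF hf] at hy'
    exact eq_neg_of_add_eq_zero_right hy'
  have hdiff : (1 - μ') • (grady (aggreg μ F f) x y' - grady (aggreg μ F f) x y) =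
      (μ - μ') • grady F x y' := by
    rw [hy, sub_zero, grady_aggreg hF hf, smul_add, smul_comm (1 - μ') (1 - μ), hf']
    module
  have hnorm := congrArg norm hdiff
  rw [norm_smul, norm_smul, Real.norm_of_nonneg hpos.le,
    Real.norm_of_nonneg (sub_nonneg.2 hle)] at hnorm
  refine h.trans ?_
  nlinarith [norm_nonneg (grady (aggreg μ F f) x y' - grady (aggreg μ F f) x y)]

/-- Dependence of the multiplier on the aggregation parameter. -/
lemma sq_mul_norm_multiplier_sub_le_param (hF : ContDiff ℝ 2 (Function.uncurry F))
    (hf : ContDiff ℝ 2 (Function.uncurry f)) {x : Eu n} {LFy2 Lfy2 LFyy2 Lfyy2 : ℝ≥0}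
    (hLFy2 : LipschitzWith LFy2 fun y => grady F x y)
    (hLfy2 : LipschitzWith Lfy2 fun y => grady f x y)
    (hLFyy2 : LipschitzWith LFyy2 fun y => hessyy F x y)
    (hLfyy2 : LipschitzWith Lfyy2 fun y => hessyy f x y)
    (hσ : 0 < σ) (hFsc : StrongConvexOn univ σ (F x)) (hfconv : ConvexOn ℝ univ (f x))
    {μ' : ℝ} (hμ' : 0 < μ') (hle : μ' ≤ μ) (hμ : μ ≤ 1 / 2) (hμ2 : μ ≤ 2 * μ')
    {y y' v v' : Eu m}
    (hy : grady (aggreg μ F f) x y = 0) (hy' : grady (aggreg μ' F f) x y' = 0)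
    (hv : hessyy (aggreg μ F f) x y v = grady F x y)
    (hv' : hessyy (aggreg μ' F f) x y' v' = grady F x y') :
    (μ * σ) ^ 2 * ‖v' - v‖ ≤
      (2 * (LFyy2 + Lfyy2) * ‖v'‖ + 2 * (2 * LFy2 + Lfy2)) * ‖grady F x y'‖ * (μ - μ') := by
  have hμ0 : 0 < μ := hμ'.trans_le hle
  have hμ1 : μ ≤ 1 := by linarith
  have hdy := mul_norm_minimizer_sub_le_param hF hf hFsc hfconv hμ'.le hle hμ hy hy'
  have hsys := mul_norm_sub_le_of_apply_eq hv' hv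
    (mul_sq_le_inner_hessyy_aggreg hF hf hFsc hfconv hμ0.le hμ1 y)
  have hH1 : ‖hessyy (aggreg μ F f) x y' - hessyy (aggreg μ F f) x y‖ ≤
      (LFyy2 + Lfyy2) * ‖y' - y‖ := by
    refine (norm_hessyy_aggreg_sub_le hF hf hμ0.le hμ1 (hLFyy2.norm_sub_le y' y)
      (hLfyy2.norm_sub_le y' y)).trans ?_
    have h1 : 0 ≤ LFyy2 * ‖y' - y‖ := by positivity
    have h2 : 0 ≤ Lfyy2 * ‖y' - y‖ := by positivity
    nlinarith
  have hH2 : ‖hessyy (aggreg μ' F f) x y' - hessyy (aggreg μ F f) x y'‖ ≤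
      (μ - μ') * (LFy2 + Lfy2) := by
    have h : hessyy (aggreg μ' F f) x y' - hessyy (aggreg μ F f) x y' =
        (μ - μ') • (hessyy f x y' - hessyy F x y') := by
      rw [hessyy_aggreg hF hf, hessyy_aggreg hF hf]
      module
    rw [h, norm_smul, Real.norm_of_nonneg (sub_nonneg.2 hle), add_comm]
    exact mul_le_mul_of_nonneg_left ((norm_sub_le _ _).trans
      (add_le_add (norm_hessyy_le hLfy2 y') (norm_hessyy_le hLFy2 y'))) (sub_nonneg.2 hle)
  have hH := (norm_sub_le_norm_sub_add_norm_sub (hessyy (aggreg μ' F f) x y')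
    (hessyy (aggreg μ F f) x y') (hessyy (aggreg μ F f) x y)).trans (add_le_add hH2 hH1)
  have hv'norm : μ * σ * ‖v'‖ ≤ 2 * ‖grady F x y'‖ := by
    have h := mul_norm_le_norm_of_mul_sq_le_inner
      (mul_sq_le_inner_hessyy_aggreg hF hf hFsc hfconv hμ'.le (by linarith) y' v')
    rw [hv'] at h
    calc μ * σ * ‖v'‖ ≤ 2 * μ' * σ * ‖v'‖ := by gcongr
      _ = 2 * (μ' * σ * ‖v'‖) := by ring
      _ ≤ 2 * ‖grady F x y'‖ := by gcongr
  have hσμ : 0 < μ * σ := mul_pos hμ0 hσ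
  have hgap := sub_nonneg.2 hle
  calc (μ * σ) ^ 2 * ‖v' - v‖ = μ * σ * (μ * σ * ‖v' - v‖) := by ring
    _ ≤ μ * σ * (((μ - μ') * (LFy2 + Lfy2) + (LFyy2 + Lfyy2) * ‖y' - y‖) * ‖v'‖ +
          LFy2 * ‖y' - y‖) := by
      refine mul_le_mul_of_nonneg_left (hsys.trans ?_) hσμ.le
      have hg := hLFy2.norm_sub_le y' y
      gcongr
    _ = ((LFyy2 + Lfyy2) * ‖v'‖ + LFy2) * (μ * σ * ‖y' - y‖) +
          (μ - μ') * (LFy2 + Lfy2) * (μ * σ * ‖v'‖) := by ring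
    _ ≤ ((LFyy2 + Lfyy2) * ‖v'‖ + LFy2) * (2 * (μ - μ') * ‖grady F x y'‖) +
          (μ - μ') * (LFy2 + Lfy2) * (2 * ‖grady F x y'‖) := by
      gcongr
    _ = _ := by ring

end Sensitivity

/-- Lemma 3.10 / D.6, `v`-error recursion. -/
theorem multiplier_error_recursion {n m : ℕ}
    (F f : Eu n → Eu m → ℝ)
    (hF : ContDiff ℝ 2 (Function.uncurry F))
    (hf : ContDiff ℝ 2 (Function.uncurry f))
    (LFy1 LFy2 Lfy1 Lfy2 LFyy1 LFyy2 Lfyy1 Lfyy2 : ℝ≥0)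
    (hLFy1 : ∀ y, LipschitzWith LFy1 fun x => grady F x y)
    (hLFy2 : ∀ x, LipschitzWith LFy2 fun y => grady F x y)
    (hLfy1 : ∀ y, LipschitzWith Lfy1 fun x => grady f x y)
    (hLfy2 : ∀ x, LipschitzWith Lfy2 fun y => grady f x y)
    (hLFyy1 : ∀ y, LipschitzWith LFyy1 fun x => hessyy F x y)
    (hLFyy2 : ∀ x, LipschitzWith LFyy2 fun y => hessyy F x y)
    (hLfyy1 : ∀ y, LipschitzWith Lfyy1 fun x => hessyy f x y)
    (hLfyy2 : ∀ x, LipschitzWith Lfyy2 fun y => hessyy f x y)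
    (σF : ℝ) (hσF : 0 < σF)
    (hFsc : ∀ x, StrongConvexOn univ σF (F x))
    (hfconv : ∀ x, ConvexOn ℝ univ (f x))
    (ystar : ℝ → Eu n → Eu m)
    (hmin : ∀ μ' ∈ Ioc (0 : ℝ) 1, ∀ x y,
      aggreg μ' F f x (ystar μ' x) ≤ aggreg μ' F f x y)
    (vstar : ℝ → Eu n → Eu m)
    (hvstar : ∀ μ' x, vstar μ' x =
      (hessyy (aggreg μ' F f) x (ystar μ' x)).inverse (grady F x (ystar μ' x)))
    (μ μplus : ℝ) (hμplus : 0 < μplus) (hle : μplus ≤ μ) (hμhalf : μ ≤ 1 / 2)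
    (hμ2 : μ ≤ 2 * μplus)
    (σψ Lψ Lψy1 Lψyy1 Lψyy2 Lv1 Lv2 Cv1 Cv2 : ℝ)
    (hσψ : σψ = μ * σF)
    (hLψ : Lψ = μ * LFy2 + (1 - μ) * Lfy2)
    (hLψy1 : Lψy1 = μ * LFy1 + (1 - μ) * Lfy1)
    (hLψyy1 : Lψyy1 = μ * LFyy1 + (1 - μ) * Lfyy1)
    (hLψyy2 : Lψyy2 = μ * LFyy2 + (1 - μ) * Lfyy2)
    (hLv1 : Lv1 = Lψyy2 * Lψy1 + Lψyy1 * σψ)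
    (hLv2 : Lv2 = LFy2 * Lψy1 + LFy1 * σψ)
    (hCv1 : Cv1 = 2 * (LFyy2 + Lfyy2) / σF ^ 2)
    (hCv2 : Cv2 = 2 * (2 * LFy2 + Lfy2) / σF ^ 2)
    (η : ℝ) (hηpos : 0 < η) (hη : η ≤ 1 / Lψ) :
    ∀ (x xp : Eu n) (y v : Eu m), ∀ vp : Eu m,
      vp = v + η • (grady F x y - hessyy (aggreg μ F f) x y v) →
      ‖vp - vstar μplus xp‖ ^ 2 - ‖v - vstar μ x‖ ^ 2 ≤
        -(1 / 2) * η * σψ * ‖v - vstar μ x‖ ^ 2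
        + (6 * (Lv1 * ‖vstar μ x‖ + Lv2) ^ 2 / (η * σψ ^ 5)) * ‖x - xp‖ ^ 2
        + (3 * η / σψ) * (Lψyy2 * ‖vstar μ x‖ + LFy2) ^ 2 * ‖y - ystar μ x‖ ^ 2
        + (6 * (Cv1 * ‖vstar μplus xp‖ + Cv2) ^ 2 *
            ‖grady F xp (ystar μplus xp)‖ ^ 2 / (η * σψ)) *
            ((μ - μplus) / μ ^ 2) ^ 2 := by

  intro x xp y v vp hvp
  have hμ : 0 < μ := hμplus.trans_le hle
  have hμ1 : μ ≤ 1 := by linarith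
  have hσ : 0 < σψ := hσψ ▸ mul_pos hμ hσF
  rcases subsingleton_or_nontrivial (Eu m) with hsub | hnt
  · rw [Subsingleton.elim vp (vstar μplus xp), Subsingleton.elim v (vstar μ x), sub_self,
      sub_self, norm_zero]
    simp only [ne_eq, OfNat.ofNat_ne_zero, not_false_eq_true, zero_pow, sub_self, mul_zero,
      zero_add]
    positivity
  have hy : ∀ ν ∈ Ioc (0 : ℝ) 1, ∀ z, grady (aggreg ν F f) z (ystar ν z) = 0 :=
    fun ν hν z => grady_eq_zero_of_forall_le (hmin ν hν z)
  have hv : ∀ ν ∈ Ioc (0 : ℝ) 1, ∀ z,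
      hessyy (aggreg ν F f) z (ystar ν z) (vstar ν z) = grady F z (ystar ν z) := fun ν hν z => by
    rw [hvstar]
    exact (isInvertible_of_mul_sq_le_inner (mul_pos hν.1 hσF) (mul_sq_le_inner_hessyy_aggreg hF hf
      (hFsc z) (hfconv z) hν.1.le hν.2 _)).self_apply_inverse _
  have hμmem : μ ∈ Ioc (0 : ℝ) 1 := ⟨hμ, hμ1⟩
  have hμpmem : μplus ∈ Ioc (0 : ℝ) 1 := ⟨hμplus, hle.trans hμ1⟩
  have hcoer := mul_sq_le_inner_hessyy_aggreg hF hf (hFsc x) (hfconv x) hμ.le hμ1 y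
  rw [← hσψ] at hcoer
  have hHnorm : ‖hessyy (aggreg μ F f) x y‖ ≤ Lψ := by
    rw [hessyy_aggreg hF hf, hLψ]
    exact norm_smul_add_one_sub_smul_le hμ.le hμ1 (norm_hessyy_le (hLFy2 x) y)
      (norm_hessyy_le (hLfy2 x) y)
  have hσL : σψ ≤ Lψ := by
    obtain ⟨u, hu⟩ := exists_ne (0 : Eu m)
    refine le_of_mul_le_mul_right ?_ (norm_pos_iff.2 hu)
    exact (mul_norm_le_norm_of_mul_sq_le_inner (hcoer u)).trans
      ((ContinuousLinearMap.le_opNorm _ u).trans (by gcongr))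
  have hηL : η * Lψ ≤ 1 := (le_div_iff₀ (hσ.trans_le hσL)).1 hη
  have hησ : η * σψ ≤ 1 := (mul_le_mul_of_nonneg_left hσL hηpos.le).trans hηL
  have hstep : ‖vp - vstar μ x‖ ≤ (1 - η * σψ) * ‖v - vstar μ x‖ +
      η * ((Lψyy2 * ‖vstar μ x‖ + LFy2) * ‖y - ystar μ x‖) := by
    set H := hessyy (aggreg μ F f) x y
    set r := (grady F x y - grady F x (ystar μ x)) -
      (H - hessyy (aggreg μ F f) x (ystar μ x)) (vstar μ x) with hr
    have hvp' : vp - vstar μ x = ((v - vstar μ x) - η • H (v - vstar μ x)) + η • r := by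
      rw [hvp, hr, sub_apply, hv μ hμmem x, map_sub]
      module
    have hrnorm : ‖r‖ ≤ (Lψyy2 * ‖vstar μ x‖ + LFy2) * ‖y - ystar μ x‖ := by
      have hHdiff := norm_hessyy_aggreg_sub_le hF hf hμ.le hμ1
        ((hLFyy2 x).norm_sub_le y (ystar μ x)) ((hLfyy2 x).norm_sub_le y (ystar μ x))
      have hop := (ContinuousLinearMap.le_opNorm
        (H - hessyy (aggreg μ F f) x (ystar μ x)) (vstar μ x)).trans
          (mul_le_mul_of_nonneg_right hHdiff (norm_nonneg _))
      refine (norm_sub_le _ _).trans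
        ((add_le_add ((hLFy2 x).norm_sub_le y (ystar μ x)) hop).trans_eq ?_)
      rw [hLψyy2]
      ring
    rw [hvp']
    refine (norm_add_le _ _).trans (add_le_add ?_ ?_)
    · exact norm_sub_smul_apply_le hηpos.le hηL hησ
        ((hF.aggreg hf μ).isSymmetric_hessyy x y) hcoer hHnorm _
    · rw [norm_smul, Real.norm_of_nonneg hηpos.le]
      gcongr
  have hdriftx : ‖vstar μ x - vstar μ xp‖ ≤
      (Lv1 * ‖vstar μ x‖ + Lv2) * ‖x - xp‖ / σψ ^ 2 := by
    have h := sq_mul_norm_multiplier_sub_le hF hf hLFy1 hLFy2 hLfy1 hLFyy1 hLFyy2 hLfyy1 hLfyy2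
      hσF hFsc hfconv hμ hμ1 (hy μ hμmem x) (hy μ hμmem xp) (hv μ hμmem x) (hv μ hμmem xp)
    rw [← hσψ, ← hLψyy2, ← hLψyy1, ← hLψy1, ← hLv1, ← hLv2] at h
    rwa [le_div_iff₀' (by positivity)]
  have hdriftμ : ‖vstar μplus xp - vstar μ xp‖ ≤
      (Cv1 * ‖vstar μplus xp‖ + Cv2) * ‖grady F xp (ystar μplus xp)‖ *
        ((μ - μplus) / μ ^ 2) := by
    have h := sq_mul_norm_multiplier_sub_le_param hF hf (hLFy2 xp) (hLfy2 xp) (hLFyy2 xp)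
      (hLfyy2 xp) hσF (hFsc xp) (hfconv xp) hμplus hle hμhalf hμ2 (hy μ hμmem xp)
      (hy μplus hμpmem xp) (hv μ hμmem xp) (hv μplus hμpmem xp)
    rw [← le_div_iff₀' (by positivity)] at h
    refine h.trans_eq ?_
    rw [hCv1, hCv2]
    field_simp
  have htotal : ‖vp - vstar μplus xp‖ ≤ (1 - η * σψ) * ‖v - vstar μ x‖ +
      η * ((Lψyy2 * ‖vstar μ x‖ + LFy2) * ‖y - ystar μ x‖) +
      ((Lv1 * ‖vstar μ x‖ + Lv2) * ‖x - xp‖ / σψ ^ 2 +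
        (Cv1 * ‖vstar μplus xp‖ + Cv2) * ‖grady F xp (ystar μplus xp)‖ *
          ((μ - μplus) / μ ^ 2)) := by
    refine (norm_sub_le_norm_sub_add_norm_sub vp (vstar μ x) _).trans (add_le_add hstep ?_)
    refine (norm_sub_le_norm_sub_add_norm_sub (vstar μ x) (vstar μ xp) _).trans
      (add_le_add hdriftx ?_)
    rwa [norm_sub_rev]
  refine (sq_sub_sq_le_of_contraction hηpos hσ hησ (norm_nonneg _) htotal).trans_eq ?_
  field_simp
  ring
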